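/- arXiv:2510.07907 — 3 statements merged into one kernel-verified Lean document; each statement's English description precedes it below -/
import Mathlib

section
/- Let N ≥ 2, let G ⊆ ℝ^N be a Lebesgue measurable set with H^{N−1}(∂^e G) < ∞, let x ∈ ℝ^N be a point of Lebesgue density 0 of G (i.e. Leb(G ∩ B(x,r))/Leb(B(x,r)) → 0 as r → 0+), and let H > 0. Then for every r₀ > 0 there exists 0 < r ≤ r₀ such that H^{N−1}(∂B(x,r) ∩ (G ∪ ∂^e G)) ≤ (1/H) · H^{N−1}(∂^e(G ∩ B(x,r))), where ∂B(x,r) denotes the sphere of center x and radius r. -/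
open MeasureTheory Metric Set Filter

noncomputable section

abbrev Pt (N : ℕ) := EuclideanSpace ℝ (Fin N)

variable {N : ℕ}

/-- The density ratio of `E` at `x` tends to `l` as the radius tends to `0⁺`. -/
def densTendsto (E : Set (Pt N)) (x : Pt N) (l : ENNReal) : Prop :=
  Tendsto (fun r : ℝ => volume (E ∩ ball x r) / volume (ball x r))
    (nhdsWithin 0 (Ioi 0)) (nhds l)

/-- The essential boundary of a set. -/
def essBdry (E : Set (Pt N)) : Set (Pt N) :=
  {x | ¬ densTendsto E x 0 ∧ ¬ densTendsto E x 1}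

/-- Weighted volume (as an extended nonnegative real). -/
def wVolE (f : Pt N → ℝ) (E : Set (Pt N)) : ENNReal :=
  ∫⁻ x in E, ENNReal.ofReal (f x) ∂(μH[(N : ℝ)])

/-- Weighted volume. -/
def wVol (f : Pt N → ℝ) (E : Set (Pt N)) : ℝ := (wVolE f E).toReal

/-- Weighted perimeter. -/
def wPer (g : Pt N → ℝ) (E : Set (Pt N)) : ℝ :=
  (∫⁻ x in essBdry E, ENNReal.ofReal (g x) ∂(μH[(N : ℝ) - 1])).toReal

/-- A density pair: lower semicontinuous, positive, locally bounded functions. -/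
def IsDensityPair (f g : Pt N → ℝ) : Prop :=
  LowerSemicontinuous f ∧ LowerSemicontinuous g ∧
  (∀ x, 0 < f x) ∧ (∀ x, 0 < g x) ∧
  ∀ K : Set (Pt N), IsCompact K → ∃ C : ℝ, ∀ x ∈ K, f x ≤ C ∧ g x ≤ C

/-- `g` is locally `α`-Hölder. -/
def LocallyHolder (α : ℝ) (g : Pt N → ℝ) : Prop :=
  ∀ K : Set (Pt N), IsCompact K → ∃ C : ℝ, ∀ y ∈ K, ∀ z ∈ K, |g y - g z| ≤ C * dist y z ^ α

/-- An `m`-cluster: measurable, essentially pairwise disjoint chambers. -/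
def IsCluster {m : ℕ} (E : Fin m → Set (Pt N)) : Prop :=
  (∀ i, MeasurableSet (E i)) ∧ ∀ i j, i ≠ j → volume (E i ∩ E j) = 0

/-- The chambers of a cluster including the exterior chamber `E₀`. -/
def chamber {m : ℕ} (E : Fin m → Set (Pt N)) (i : Fin (m + 1)) : Set (Pt N) :=
  if h : i = 0 then (⋃ j, E j)ᶜ else E (i.pred h)

/-- The weighted perimeter of a cluster. -/
def clPer (g : Pt N → ℝ) {m : ℕ} (E : Fin m → Set (Pt N)) : ℝ :=
  ((∑ i, wPer g (E i)) + wPer g (⋃ i, E i)) / 2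

/-- The cluster has finite perimeter. -/
def FinPerCluster {m : ℕ} (E : Fin m → Set (Pt N)) : Prop :=
  ∀ i, μH[(N : ℝ) - 1] (essBdry (E i)) < ⊤

/-- The cluster has finite weighted volume. -/
def FinVolCluster (f : Pt N → ℝ) {m : ℕ} (E : Fin m → Set (Pt N)) : Prop :=
  ∀ i, wVolE f (E i) < ⊤

/-- Nondegeneracy: all chambers including the exterior one have positive Lebesgue measure. -/
def Nondegenerate {m : ℕ} (E : Fin m → Set (Pt N)) : Prop :=
  0 < volume ((⋃ i, E i)ᶜ) ∧ ∀ i, 0 < volume (E i)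

/-- The `ε`–`ε^β` property for clusters with constants `(rbar, εbar, Cper)`. -/
def EpsEpsBeta (f g : Pt N → ℝ) {m : ℕ} (E : Fin m → Set (Pt N))
    (β rbar εbar Cper : ℝ) : Prop :=
  ∀ ε : EuclideanSpace ℝ (Fin m), ‖ε‖ < εbar → ∀ w : Pt N,
    ∃ F : Fin m → Set (Pt N), IsCluster F ∧
      (∃ (c : Fin (m * (m + 1) / 2 + 1) → Pt N) (ρ : Fin (m * (m + 1) / 2 + 1) → ℝ),
        (∀ k, ρ k ≤ rbar) ∧
        (∀ k, Disjoint (ball (c k) (ρ k)) (ball w rbar)) ∧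
        (⋃ i, symmDiff (E i) (F i)) ⊆ ⋃ k, ball (c k) (ρ k)) ∧
      (∀ i, wVol f (F i) = wVol f (E i) + ε i) ∧
      clPer g F ≤ clPer g E + Cper * ‖ε‖ ^ β


theorem le_mul_of_pow_growth {r₀ c : ℝ} (hc : 0 < c) (n : ℕ) {v : ℝ → ℝ}
    (hmono : MonotoneOn v (Ioc 0 r₀)) (hpos : ∀ r ∈ Ioc 0 r₀, 0 < v r)
    (h : ∀ a b, 0 < a → a < b → b ≤ r₀ →
      v a ^ (n + 1) + c * (b - a) * v a ^ n ≤ v b ^ (n + 1)) :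
    ∀ b ∈ Ioc 0 r₀, b ≤ 2 ^ (n + 2) / c * v b := by
  have key : ∀ j : ℕ, ∀ a b, 0 < a → a ≤ b → b ≤ r₀ → v b < 2 ^ j * v a →
      b - a ≤ 2 ^ (n + 2) / c * v b := by
    intro j
    induction j with
    | zero =>
      intro a b ha hab hb hlt
      have := hmono ⟨ha, hab.trans hb⟩ ⟨ha.trans_le hab, hb⟩ hab
      rw [pow_zero, one_mul] at hlt
      exact absurd hlt this.not_gt
    | succ j ih =>
      intro a b ha hab hb hlt
      have hvb := hpos b ⟨ha.trans_le hab, hb⟩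
      obtain ⟨τ, hτ⟩ : ∃ τ, τ = 2 ^ (n + 1) / c * v b := ⟨_, rfl⟩
      have hτ0 : 0 < τ := by rw [hτ]; positivity
      have hK : 2 ^ (n + 2) / c * v b = 2 * τ := by rw [hτ]; ring
      rw [hK]
      rcases le_or_gt (b - τ) a with hle | hlt'
      · linarith
      have hb'0 : 0 < b - τ := ha.trans hlt'
      have hb'r : b - τ ≤ r₀ := by linarith
      have hhalf : v (b - τ) ≤ v b / 2 := by
        by_contra! hcon
        have h1 := h (b - τ) b hb'0 (by linarith) hb
        have h2 : (v b / 2) ^ n ≤ v (b - τ) ^ n := by gcongr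
        have h3 : c * (b - (b - τ)) * (v b / 2) ^ n = 2 * v b ^ (n + 1) := by
          rw [sub_sub_cancel, hτ, div_pow]
          field_simp
          ring
        have h4 : c * (b - (b - τ)) * (v b / 2) ^ n ≤ c * (b - (b - τ)) * v (b - τ) ^ n := by
          apply mul_le_mul_of_nonneg_left h2
          rw [sub_sub_cancel]
          positivity
        have h5 : 0 < v b ^ (n + 1) := by positivity
        have h6 : 0 < v (b - τ) ^ (n + 1) := pow_pos (hpos _ ⟨hb'0, hb'r⟩) _
        linarith
      have h1 := ih a (b - τ) ha hlt'.le hb'r (by rw [pow_succ] at hlt; linarith)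
      have h2 : 2 ^ (n + 2) / c * v (b - τ) ≤ 2 ^ (n + 2) / c * (v b / 2) := by gcongr
      have h3 : 2 ^ (n + 2) / c * (v b / 2) = τ := by rw [hτ]; ring
      linarith
  intro b hb
  refine le_of_forall_pos_sub_le fun a ha => ?_
  rcases le_or_gt b a with hba | hab
  · have := hpos b hb
    have : 0 < 2 ^ (n + 2) / c * v b := by positivity
    linarith
  · have hva := hpos a ⟨ha, hab.le.trans hb.2⟩
    obtain ⟨j, hj⟩ := pow_unbounded_of_one_lt (v b / v a) (one_lt_two)
    exact key j a b ha hab.le hb.2 (by rwa [div_lt_iff₀ hva] at hj)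

/-- A form of Eilenberg's inequality: the Hausdorff measures of the slices of a set by a
`1`-Lipschitz function have a measurable majorant of controlled integral. -/
theorem exists_measurable_majorant_hausdorffMeasure_slice {X : Type*} [MetricSpace X]
    [MeasurableSpace X] [BorelSpace X] {f : X → ℝ} (hf : LipschitzWith 1 f) {d : ℝ} (hd : 0 < d)
    (A : Set X) :
    ∃ g : ℝ → ENNReal, Measurable g ∧ (∀ t, μH[d] (A ∩ f ⁻¹' {t}) ≤ g t) ∧
      ∫⁻ t, g t ≤ μH[d + 1] A := by
  rcases eq_or_ne (μH[d + 1] A) ⊤ with htop | hfin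
  · exact ⟨fun _ => ⊤, measurable_const, fun _ => le_top, by simp [htop]⟩
  let ε : ℕ → ENNReal := fun n => ((n : ENNReal) + 1)⁻¹
  have hε0 : ∀ n, 0 < ε n := fun n => by simp [ε]
  have hεt : Tendsto ε atTop (nhds 0) := by
    have := ENNReal.tendsto_inv_nat_nhds_zero.comp (tendsto_add_atTop_nat 1)
    refine this.congr fun n => ?_
    simp [ε]
  have hcov : ∀ n, ∃ t : ℕ → Set X, A ⊆ ⋃ i, t i ∧ (∀ i, ediam (t i) ≤ ε n) ∧
      ∑' i, ediam (t i) ^ (d + 1) ≤ μH[d + 1] A + ε n := by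
    intro n
    have h1 : (⨅ (t : ℕ → Set X) (_ : A ⊆ ⋃ n, t n) (_ : ∀ i, ediam (t i) ≤ ε n),
        ∑' i, ⨆ _ : (t i).Nonempty, ediam (t i) ^ (d + 1)) ≤ μH[d + 1] A := by
      conv_rhs => rw [Measure.hausdorffMeasure_apply]
      exact le_iSup₂_of_le (ε n) (hε0 n) le_rfl
    have h2 := h1.trans_lt (ENNReal.lt_add_right hfin (hε0 n).ne')
    simp only [iInf_lt_iff] at h2
    obtain ⟨t, ht1, ht2, ht3⟩ := h2
    refine ⟨t, ht1, ht2, le_trans (ENNReal.tsum_le_tsum fun i => ?_) ht3.le⟩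
    rcases (t i).eq_empty_or_nonempty with he | hne
    · simp [he, ENNReal.zero_rpow_of_pos (by linarith : 0 < d + 1)]
    · simp [hne]
  choose t ht1 ht2 ht3 using hcov
  let S : ℕ → ℕ → Set ℝ := fun n i => toMeasurable volume (f '' t n i)
  let F : ℕ → ℝ → ENNReal := fun n u =>
    ∑' i, (S n i).indicator (fun _ => ediam (t n i) ^ d) u
  have hFm : ∀ n, Measurable (F n) := fun n =>
    Measurable.tsum fun i => measurable_const.indicator (measurableSet_toMeasurable _ _)
  refine ⟨fun u => liminf (fun n => F n u) atTop, Measurable.liminf hFm, fun u => ?_, ?_⟩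
  · refine (Measure.hausdorffMeasure_le_liminf_tsum d _ ε hεt
      (fun n i => t n i ∩ f ⁻¹' {u}) (Eventually.of_forall fun n i => ?_)
      (Eventually.of_forall fun n => ?_)).trans (liminf_le_liminf (Eventually.of_forall fun n => ?_))
    · exact (ediam_mono inter_subset_left).trans (ht2 n i)
    · rw [← iUnion_inter]
      exact inter_subset_inter_left _ (ht1 n)
    · refine ENNReal.tsum_le_tsum fun i => ?_
      rcases (t n i ∩ f ⁻¹' {u}).eq_empty_or_nonempty with he | ⟨y, hy1, hy2⟩
      · simp [he, ENNReal.zero_rpow_of_pos hd]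
      · rw [indicator_of_mem (subset_toMeasurable _ _ (show u ∈ f '' t n i from ⟨y, hy1, hy2⟩))]
        exact ENNReal.rpow_le_rpow (ediam_mono inter_subset_left) hd.le
  · refine (lintegral_liminf_le hFm).trans ?_
    have hle : ∀ n, ∫⁻ u, F n u ≤ μH[d + 1] A + ε n := by
      intro n
      refine le_trans ?_ (ht3 n)
      rw [lintegral_tsum fun i =>
        (measurable_const.indicator (measurableSet_toMeasurable _ _)).aemeasurable]
      refine ENNReal.tsum_le_tsum fun i => ?_
      rw [lintegral_indicator_const (measurableSet_toMeasurable _ _), measure_toMeasurable]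
      have h1 : volume (f '' t n i) ≤ ediam (t n i) := by
        refine (Real.volume_le_diam _).trans ?_
        simpa using hf.ediam_image_le (t n i)
      calc ediam (t n i) ^ d * volume (f '' t n i) ≤ ediam (t n i) ^ d * ediam (t n i) := by gcongr
        _ = ediam (t n i) ^ (d + 1) := by
          rw [ENNReal.rpow_add_of_nonneg _ _ hd.le zero_le_one, ENNReal.rpow_one]
    refine (liminf_le_liminf (Eventually.of_forall hle)).trans ?_
    have : Tendsto (fun n => μH[d + 1] A + ε n) atTop (nhds (μH[d + 1] A + 0)) :=
      hεt.const_add _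
    rw [add_zero] at this
    exact this.liminf_eq.le

/-- If `t₀ ∈ A`, `b ∉ A`, and every frontier point of `A` close to `t₀` lies in `A`, then some point
of `A` is followed, in one of the two directions, by a segment missing `A`. -/
theorem exists_mem_forall_add_notMem {A : Set ℝ} {t₀ σ b η : ℝ} (hσ : |σ| = 1) (hb : 0 < b)
    (hbη : b < η) (hA : t₀ ∈ A) (hbA : t₀ + σ * b ∉ A)
    (hK : ∀ t ∈ frontier A, |t - t₀| < η → t ∈ A) :
    ∃ t ∈ A, ∃ δ > 0, ∀ s, 0 < s → s < δ → t + σ * s ∉ A := by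
  have hcont : Continuous fun u : ℝ => t₀ + σ * u := by fun_prop
  let V : Set ℝ := {u | u ∈ Icc 0 b ∧ t₀ + σ * u ∈ A}
  have h0 : (0 : ℝ) ∈ V := ⟨⟨le_rfl, hb.le⟩, by simpa using hA⟩
  have hbd : BddAbove V := ⟨b, fun u hu => hu.1.2⟩
  obtain ⟨c, hc⟩ : ∃ c, c = sSup V := ⟨_, rfl⟩
  have hc0 : 0 ≤ c := hc ▸ le_csSup hbd h0
  have hcb : c ≤ b := hc ▸ csSup_le ⟨0, h0⟩ fun u hu => hu.1.2
  have hout : ∀ u, c < u → u ≤ b → t₀ + σ * u ∉ A := fun u hu hub hmem =>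
    hu.not_ge (hc ▸ le_csSup hbd ⟨⟨hc0.trans hu.le, hub⟩, hmem⟩)
  have hcl : t₀ + σ * c ∈ closure A := by
    have h1 : c ∈ closure V := hc ▸ csSup_mem_closure ⟨0, h0⟩ hbd
    exact map_mem_closure (f := fun u : ℝ => t₀ + σ * u) hcont h1 fun u hu => hu.2
  have hcA : t₀ + σ * c ∈ A := by
    by_contra hcon
    refine hcon (hK _ ⟨hcl, fun hint => hcon (interior_subset hint)⟩ ?_)
    rw [add_sub_cancel_left, abs_mul, hσ, one_mul, abs_of_nonneg hc0]
    linarith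
  have hcb' : c < b := lt_of_le_of_ne hcb fun h => hbA (h ▸ hcA)
  refine ⟨_, hcA, b - c, by linarith, fun s hs hsb => ?_⟩
  have := hout (c + s) (by linarith) (by linarith)
  rwa [mul_add, ← add_assoc] at this

/-- The real line is not the disjoint union of two nonempty `F_σ` sets unless one of them has a
point that is followed, in one of the two directions, by a segment of the other. -/
theorem exists_one_sided_transition {A : Set ℝ} {K L : ℕ → Set ℝ} (hKc : ∀ k, IsClosed (K k))
    (hLc : ∀ k, IsClosed (L k)) (hK : A = ⋃ k, K k) (hL : Aᶜ = ⋃ k, L k) (hne : A.Nonempty)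
    (hne' : Aᶜ.Nonempty) :
    ∃ σ : ℝ, (σ = 1 ∨ σ = -1) ∧ ∃ t δ, 0 < δ ∧
      ((t ∈ A ∧ ∀ s, 0 < s → s < δ → t + σ * s ∉ A) ∨
        (t ∉ A ∧ ∀ s, 0 < s → s < δ → t + σ * s ∈ A)) := by
  have hfr : (frontier A).Nonempty := by
    rw [nonempty_iff_ne_empty, Ne, frontier_eq_empty_iff]
    rintro (h | h)
    · simp [h] at hne
    · simp [h] at hne'
  have : Nonempty (frontier A) := hfr.to_subtype
  have : CompleteSpace (frontier A) := isClosed_frontier.completeSpace_coe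
  obtain ⟨i, t₀, ht₀⟩ := nonempty_interior_of_iUnion_of_closed
    (f := fun i : ℕ ⊕ ℕ => ((↑) : frontier A → ℝ) ⁻¹' (Sum.elim K L i))
    (by
      rintro (k | k)
      · exact (hKc k).preimage continuous_subtype_val
      · exact (hLc k).preimage continuous_subtype_val)
    (by
      refine eq_univ_of_forall fun t => ?_
      by_cases ht : (t : ℝ) ∈ A
      · obtain ⟨k, hk⟩ := mem_iUnion.1 (hK.subset ht)
        exact mem_iUnion.2 ⟨Sum.inl k, hk⟩
      · obtain ⟨k, hk⟩ := mem_iUnion.1 (hL.subset ht)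
        exact mem_iUnion.2 ⟨Sum.inr k, hk⟩)
  rw [mem_interior_iff_mem_nhds, Metric.mem_nhds_iff] at ht₀
  obtain ⟨η, hη, hball⟩ := ht₀
  have main : ∀ B : Set ℝ, (t₀ : ℝ) ∈ frontier B → (∀ t ∈ frontier B, |t - t₀| < η → t ∈ B) →
      ∃ σ : ℝ, (σ = 1 ∨ σ = -1) ∧ ∃ t ∈ B, ∃ δ > 0, ∀ s, 0 < s → s < δ → t + σ * s ∉ B := by
    intro B hB hBη
    have ht₀B : (t₀ : ℝ) ∈ B := hBη _ hB (by simpa using hη)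
    have hcl : (t₀ : ℝ) ∈ closure Bᶜ := by
      rw [frontier_eq_closure_inter_closure] at hB
      exact hB.2
    obtain ⟨b, hbB, hb⟩ := Metric.mem_closure_iff.1 hcl η hη
    rw [Real.dist_eq] at hb
    rcases lt_trichotomy (t₀ : ℝ) b with h | h | h
    · rw [abs_sub_comm, abs_of_pos (by linarith)] at hb
      exact ⟨1, Or.inl rfl, exists_mem_forall_add_notMem (by simp) (sub_pos.2 h) hb ht₀B
        (by simpa using hbB) hBη⟩
    · exact absurd (h ▸ ht₀B) hbB
    · rw [abs_of_pos (by linarith)] at hb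
      exact ⟨-1, Or.inr rfl, exists_mem_forall_add_notMem (by simp) (sub_pos.2 h) hb ht₀B
        (by simpa using hbB) hBη⟩
  rcases i with k | k
  · obtain ⟨σ, hσ, t, ht, δ, hδ, h⟩ := main A t₀.2 fun t ht htη => by
      have : (⟨t, ht⟩ : frontier A) ∈ ball t₀ η := by
        rwa [mem_ball, Subtype.dist_eq, Real.dist_eq]
      rw [hK]
      exact mem_iUnion.2 ⟨k, hball this⟩
    exact ⟨σ, hσ, t, δ, hδ, Or.inl ⟨ht, h⟩⟩
  · obtain ⟨σ, hσ, t, ht, δ, hδ, h⟩ := main Aᶜ (by rw [frontier_compl]; exact t₀.2)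
      fun t ht htη => by
      rw [frontier_compl] at ht
      have : (⟨t, ht⟩ : frontier A) ∈ ball t₀ η := by
        rwa [mem_ball, Subtype.dist_eq, Real.dist_eq]
      rw [hL]
      exact mem_iUnion.2 ⟨k, hball this⟩
    exact ⟨σ, hσ, t, δ, hδ, Or.inr ⟨ht, fun s h1 h2 => not_not.1 (h s h1 h2)⟩⟩

/-- The points of density `0` of a set. -/
def densZero (E : Set (Pt N)) : Set (Pt N) := {x | densTendsto E x 0}

theorem inter_ball_div_add_compl {E : Set (Pt N)} (hE : MeasurableSet E) (x : Pt N) {r : ℝ}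
    (hr : 0 < r) : volume (E ∩ ball x r) / volume (ball x r) +
      volume (Eᶜ ∩ ball x r) / volume (ball x r) = 1 := by
  rw [← ENNReal.add_div, inter_comm E, inter_comm Eᶜ, ← sdiff_eq, measure_inter_add_sdiff _ hE]
  exact ENNReal.div_self (measure_ball_pos _ _ hr).ne' measure_ball_lt_top.ne

theorem inter_ball_div_le_one (E : Set (Pt N)) (x : Pt N) (r : ℝ) :
    volume (E ∩ ball x r) / volume (ball x r) ≤ 1 :=
  ENNReal.div_le_of_le_mul (by rw [one_mul]; exact measure_mono inter_subset_right)

theorem densTendsto_one_iff {E : Set (Pt N)} (hE : MeasurableSet E) (x : Pt N) :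
    densTendsto E x 1 ↔ densTendsto Eᶜ x 0 := by
  have key : ∀ F : Set (Pt N), MeasurableSet F → ∀ l : ENNReal, densTendsto F x l →
      densTendsto Fᶜ x (1 - l) := by
    intro F hF l h
    have h1 := ENNReal.Tendsto.sub (tendsto_const_nhds (x := (1 : ENNReal))) h
      (Or.inl ENNReal.one_ne_top)
    refine h1.congr' ?_
    filter_upwards [self_mem_nhdsWithin] with r hr
    refine ENNReal.sub_eq_of_eq_add_rev
      (ne_top_of_le_ne_top ENNReal.one_ne_top (inter_ball_div_le_one F x r)) ?_
    exact (inter_ball_div_add_compl hF x hr).symm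
  constructor
  · intro h
    simpa using key E hE 1 h
  · intro h
    simpa using key Eᶜ hE.compl 0 h

theorem essBdry_eq_compl {E : Set (Pt N)} (hE : MeasurableSet E) :
    essBdry E = (densZero E ∪ densZero Eᶜ)ᶜ := by
  ext x
  simp only [essBdry, densZero, mem_ofPred_eq, compl_union, mem_inter_iff, mem_compl_iff,
    densTendsto_one_iff hE]

theorem ae_densTendsto_indicator {E : Set (Pt N)} (hE : MeasurableSet E) :
    ∀ᵐ x, densTendsto E x (E.indicator 1 x) := by
  filter_upwards [Besicovitch.ae_tendsto_measure_inter_div_of_measurableSet volume hE] with x hx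
  refine hx.congr' ?_
  filter_upwards [self_mem_nhdsWithin] with r hr
  have h : (closedBall x r : Set (Pt N)) =ᵐ[volume] ball x r := by
    rw [← ball_union_sphere]
    exact union_ae_eq_left_of_ae_eq_empty
      (ae_eq_empty.2 (Measure.addHaar_sphere_of_ne_zero _ _ (ne_of_gt hr)))
  rw [measure_congr h, measure_congr ((ae_eq_refl E).inter h)]

theorem volume_densZero_inter {E : Set (Pt N)} (hE : MeasurableSet E) :
    volume (densZero E ∩ E) = 0 := by
  rw [measure_eq_zero_iff_ae_notMem]
  filter_upwards [ae_densTendsto_indicator hE] with x hx h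
  rw [indicator_of_mem h.2] at hx
  exact zero_ne_one (tendsto_nhds_unique h.1 hx)

theorem volume_diff_densZero_compl {E : Set (Pt N)} (hE : MeasurableSet E) :
    volume (E \ densZero Eᶜ) = 0 := by
  rw [measure_eq_zero_iff_ae_notMem]
  filter_upwards [ae_densTendsto_indicator hE] with x hx h
  rw [indicator_of_mem h.1] at hx
  exact h.2 ((densTendsto_one_iff hE x).1 hx)

/-- The points at which the density ratio of `F` is at most `ε` at all scales below `h`. -/
def smallDensity (F : Set (Pt N)) (ε : ENNReal) (h : ℝ) : Set (Pt N) :=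
  {x | ∀ ρ, 0 < ρ → ρ < h → volume (F ∩ ball x ρ) ≤ ε * volume (ball x ρ)}

theorem volume_ball_eq (x y : Pt N) (r : ℝ) : volume (ball x r) = volume (ball y r) := by
  rw [Measure.addHaar_ball_center, ← Measure.addHaar_ball_center volume y]

theorem isClosed_smallDensity (F : Set (Pt N)) (ε : ENNReal) (h : ℝ) :
    IsClosed (smallDensity F ε h) := by
  rw [← isOpen_compl_iff, Metric.isOpen_iff]
  intro x hx
  simp only [smallDensity, mem_compl_iff, mem_ofPred_eq, not_forall, not_le] at hx
  obtain ⟨ρ, hρ, hρh, hlt⟩ := hx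
  obtain ⟨u, hum, hu⟩ := exists_seq_strictMono_tendsto ρ
  have hun : F ∩ ball x ρ = ⋃ k, F ∩ ball x (u k) := by
    rw [← inter_iUnion]
    congr 1
    ext y
    simp only [mem_ball, mem_iUnion]
    exact ⟨fun hy => (hu.2.eventually_const_lt hy).exists, fun ⟨k, hk⟩ => hk.trans (hu.1 k)⟩
  have hmono : Monotone fun k => F ∩ ball x (u k) := fun a b hab =>
    inter_subset_inter_right _ (ball_subset_ball (hum.monotone hab))
  rw [hun, hmono.measure_iUnion, lt_iSup_iff] at hlt
  obtain ⟨k, hk⟩ := hlt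
  refine ⟨ρ - u k, sub_pos.2 (hu.1 k), fun y hy hy' => ?_⟩
  have hsub : F ∩ ball x (u k) ⊆ F ∩ ball y ρ := by
    refine inter_subset_inter_right _ (ball_subset_ball' ?_)
    rw [mem_ball, dist_comm] at hy
    linarith
  have := (measure_mono hsub).trans (hy' ρ hρ hρh)
  rw [volume_ball_eq y x] at this
  exact this.not_gt hk

theorem exists_mem_smallDensity {F : Set (Pt N)} {x : Pt N} (hx : x ∈ densZero F) {ε : ENNReal}
    (hε : 0 < ε) {δ : ℝ} (hδ : 0 < δ) :
    ∃ k : ℕ, 1 / ((k : ℝ) + 1) < δ ∧ x ∈ smallDensity F ε (1 / ((k : ℝ) + 1)) := by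
  have h1 : ∀ᶠ r in nhdsWithin (0 : ℝ) (Ioi 0),
      volume (F ∩ ball x r) / volume (ball x r) < ε := hx.eventually_lt_const hε
  rw [eventually_nhdsWithin_iff, Metric.eventually_nhds_iff] at h1
  obtain ⟨η, hη, h⟩ := h1
  obtain ⟨k, hk⟩ := exists_nat_one_div_lt (lt_min hδ hη)
  refine ⟨k, hk.trans_le (min_le_left _ _), fun ρ hρ hρk => ?_⟩
  have h2 := h (y := ρ) (by
    rw [Real.dist_eq, sub_zero, abs_of_pos hρ]
    exact hρk.trans (hk.trans_le (min_le_right _ _))) hρ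
  exact (ENNReal.div_le_iff (measure_ball_pos _ _ hρ).ne' measure_ball_lt_top.ne).1 h2.le

theorem notMem_densZero_compl_of_mem_smallDensity {F : Set (Pt N)} (hF : MeasurableSet F)
    {x : Pt N} {ε : ENNReal} (hε : ε < 1) {h : ℝ} (hh : 0 < h) (hx : x ∈ smallDensity F ε h) :
    x ∉ densZero Fᶜ := by
  intro hx'
  have h1 : densTendsto F x 1 := (densTendsto_one_iff hF x).2 hx'
  have h2 : ∀ᶠ r in nhdsWithin (0 : ℝ) (Ioi 0),
      volume (F ∩ ball x r) / volume (ball x r) ≤ ε := by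
    filter_upwards [Ioo_mem_nhdsGT hh] with r hr
    exact ENNReal.div_le_of_le_mul (hx r hr.1 hr.2)
  exact (le_of_tendsto h1 h2).not_gt hε

/-- The measurable splitting of a point into its `i`-th coordinate and the other ones. -/
def splitCoord (n : ℕ) (i : Fin (n + 1)) : Pt (n + 1) ≃ᵐ ℝ × (Fin n → ℝ) :=
  (MeasurableEquiv.toLp 2 (Fin (n + 1) → ℝ)).symm.trans
    (MeasurableEquiv.piFinSuccAbove (fun _ => ℝ) i)

theorem splitCoord_apply {n : ℕ} (i : Fin (n + 1)) (x : Pt (n + 1)) :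
    splitCoord n i x = (x i, fun j => x (i.succAbove j)) := rfl

theorem measurePreserving_splitCoord {n : ℕ} (i : Fin (n + 1)) :
    MeasurePreserving (splitCoord n i) volume volume :=
  (volume_preserving_piFinSuccAbove (fun _ => ℝ) i).comp (PiLp.volume_preserving_ofLp _)

/-- The projection forgetting the `i`-th coordinate. -/
def dropCoord {n : ℕ} (i : Fin (n + 1)) (x : Pt (n + 1)) : Fin n → ℝ := fun j => x (i.succAbove j)

theorem dropCoord_add_single {n : ℕ} (i : Fin (n + 1)) (x : Pt (n + 1)) (s : ℝ) :
    dropCoord i (x + EuclideanSpace.single i s) = dropCoord i x := by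
  ext j
  simp [dropCoord]

theorem eq_add_single_of_dropCoord_eq {n : ℕ} {i : Fin (n + 1)} {x y : Pt (n + 1)}
    (h : dropCoord i y = dropCoord i x) : y = x + EuclideanSpace.single i (y i - x i) := by
  ext k
  rcases Fin.eq_self_or_eq_succAbove i k with rfl | ⟨j, rfl⟩
  · simp
  · simpa [dropCoord] using congrFun h j

theorem lipschitzWith_dropCoord {n : ℕ} (i : Fin (n + 1)) :
    LipschitzWith 1 (dropCoord i) := by
  refine LipschitzWith.of_dist_le_mul fun x y => ?_
  rw [NNReal.coe_one, one_mul, dist_pi_le_iff dist_nonneg]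
  intro j
  rw [EuclideanSpace.dist_eq]
  refine Real.le_sqrt_of_sq_le ?_
  exact Finset.single_le_sum (f := fun k => dist (x k) (y k) ^ 2) (fun k _ => sq_nonneg _)
    (Finset.mem_univ (i.succAbove j))

theorem volume_image_dropCoord_le {n : ℕ} (i : Fin (n + 1)) (A : Set (Pt (n + 1))) :
    volume (dropCoord i '' A) ≤ μH[(n : ℝ)] A := by
  have h := (lipschitzWith_dropCoord i).hausdorffMeasure_image_le (Nat.cast_nonneg n) A
  have h2 := hausdorffMeasure_pi_real (ι := Fin n)
  rw [Fintype.card_fin] at h2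
  rwa [h2, ENNReal.coe_one, ENNReal.one_rpow, one_mul] at h

theorem dist_lt_of_coord_le {n : ℕ} {x y : Pt (n + 1)} {r : ℝ} (hr : 0 < r)
    (h : ∀ k, dist (x k) (y k) ≤ 2 * r) : dist x y < 2 * (n + 2) * r := by
  rw [EuclideanSpace.dist_eq, Real.sqrt_lt' (by positivity)]
  calc ∑ k, dist (x k) (y k) ^ 2 ≤ ∑ _k : Fin (n + 1), (2 * r) ^ 2 :=
        Finset.sum_le_sum fun k _ => by gcongr; exact h k
    _ = (n + 1) * (2 * r) ^ 2 := by simp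
    _ < (2 * (n + 2) * r) ^ 2 := by
        have : 0 < r ^ 2 := by positivity
        nlinarith [this, (Nat.cast_nonneg n : (0 : ℝ) ≤ n),
          mul_nonneg (Nat.cast_nonneg n : (0 : ℝ) ≤ n) this.le,
          mul_nonneg (mul_nonneg (Nat.cast_nonneg n : (0 : ℝ) ≤ n) this.le)
            (Nat.cast_nonneg n : (0 : ℝ) ≤ n)]

/-- A density threshold for which one-sided transitions are negligible. -/
def IsThreshold (n : ℕ) (ε : ENNReal) : Prop :=
  0 < ε ∧ ε < 1 ∧
    ε * (ENNReal.ofReal ((2 * (n + 2)) ^ (n + 1)) * volume (ball (0 : Pt (n + 1)) 1)) ≤ 4⁻¹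

theorem exists_isThreshold (n : ℕ) : ∃ ε, IsThreshold n ε := by
  obtain ⟨c, hc⟩ : ∃ c, c = ENNReal.ofReal ((2 * (n + 2)) ^ (n + 1)) *
    volume (ball (0 : Pt (n + 1)) 1) := ⟨_, rfl⟩
  have hct : c ≠ ⊤ := hc ▸ ENNReal.mul_ne_top ENNReal.ofReal_ne_top measure_ball_lt_top.ne
  refine ⟨min 2⁻¹ (4⁻¹ / c), lt_min (by simp) ?_, (min_le_left _ _).trans_lt ?_, ?_⟩
  · exact ENNReal.div_pos (by simp) hct
  · exact ENNReal.one_half_lt_one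
  · rw [← hc]
    calc min 2⁻¹ (4⁻¹ / c) * c ≤ 4⁻¹ / c * c := by gcongr; exact min_le_right _ _
      _ ≤ 4⁻¹ := by rw [mul_comm]; exact ENNReal.mul_div_le

theorem volume_eq_zero_of_inter_closedBall_le {n : ℕ} {T : Set (Fin n → ℝ)} {η : ℝ} (hη : 0 < η)
    (h : ∀ z r, 0 < r → r < η → volume (T ∩ closedBall z r) ≤ 2⁻¹ * volume (closedBall z r)) :
    volume T = 0 := by
  have h1 := Besicovitch.ae_tendsto_measure_inter_div (volume : Measure (Fin n → ℝ)) T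
  have h2 : ∀ᵐ z ∂(volume.restrict T), False := by
    filter_upwards [h1] with z hz
    have h3 : ∀ᶠ r in nhdsWithin (0 : ℝ) (Ioi 0),
        volume (T ∩ closedBall z r) / volume (closedBall z r) ≤ 2⁻¹ := by
      filter_upwards [Ioo_mem_nhdsGT hη] with r hr
      exact ENNReal.div_le_of_le_mul (h z r hr.1 hr.2)
    exact (le_of_tendsto hz h3).not_gt ENNReal.one_half_lt_one
  rw [eventually_false_iff_eq_bot, ae_eq_bot, Measure.restrict_eq_zero] at h2
  exact h2

theorem volume_inter_closedBall_le_of_slab {n : ℕ} (i : Fin (n + 1)) {O F : Set (Pt (n + 1))}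
    (hOF : volume (O \ F) = 0) {ε : ENNReal} (hε : IsThreshold n ε) {σ : ℝ}
    (hσ : σ = 1 ∨ σ = -1) {h a : ℝ} {S : Set (Pt (n + 1))} (hSF : S ⊆ smallDensity F ε h)
    (hSO : ∀ x ∈ S, ∀ s, 0 < s → s < h → x + EuclideanSpace.single i (σ * s) ∈ O)
    (hSa : ∀ x ∈ S, a ≤ σ * x i ∧ σ * x i ≤ a + h / 3) (z : Fin n → ℝ) {r : ℝ} (hr : 0 < r)
    (hrh : 2 * (n + 2) * r < h) :
    volume (dropCoord i '' S ∩ closedBall z r) ≤ 2⁻¹ * volume (closedBall z r) := by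
  rcases (dropCoord i '' S ∩ closedBall z r).eq_empty_or_nonempty with he | hne
  · simp [he]
  have hσ2 : σ * σ = 1 := by rcases hσ with rfl | rfl <;> norm_num
  have hσa : |σ| = 1 := by rcases hσ with rfl | rfl <;> norm_num
  have hn : (0 : ℝ) ≤ n := Nat.cast_nonneg n
  have hrh' : 4 * r < h := by nlinarith
  obtain ⟨V, hV⟩ : ∃ V, V = (fun x : Pt (n + 1) => σ * x i) ''
    {x | x ∈ S ∧ dropCoord i x ∈ closedBall z r} := ⟨_, rfl⟩
  have hVne : V.Nonempty := by
    obtain ⟨_, ⟨x, hx, rfl⟩, hxz⟩ := hne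
    exact hV ▸ ⟨_, x, ⟨hx, hxz⟩, rfl⟩
  have hVbd : BddAbove V := ⟨a + h / 3, by
    rw [hV]
    rintro _ ⟨x, hx, rfl⟩
    exact (hSa x hx.1).2⟩
  obtain ⟨_, hbV, hb⟩ := exists_lt_of_lt_csSup hVne (show sSup V - r / 2 < sSup V by linarith)
  have hbV' := hbV
  rw [hV] at hbV'
  obtain ⟨b, ⟨hbS, hbz⟩, rfl⟩ := hbV'
  let I : Set ℝ := {u | σ * u ∈ Ioo (σ * b i + r / 2) (σ * b i + r)}
  have hI : volume I = ENNReal.ofReal (r / 2) := by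
    have : I = (fun u => σ * u) ⁻¹' Ioo (σ * b i + r / 2) (σ * b i + r) := rfl
    rw [this, Real.volume_preimage_mul_left (by rintro rfl; simp at hσa), Real.volume_Ioo, abs_inv,
      hσa]
    simp only [inv_one, ENNReal.ofReal_one, one_mul]
    congr 1
    ring
  have hsub : splitCoord n i ⁻¹' (I ×ˢ (dropCoord i '' S ∩ closedBall z r)) ⊆
      O ∩ ball b (2 * (n + 2) * r) := by
    rintro y ⟨⟨hy1, hy2⟩, ⟨x, hxS, hxy⟩, hyz⟩
    rw [splitCoord_apply] at hy1 hy2 hxy hyz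
    change dropCoord i x = dropCoord i y at hxy
    change dropCoord i y ∈ closedBall z r at hyz
    simp only at hy1 hy2
    constructor
    · have hx1 : σ * x i ≤ sSup V := le_csSup hVbd (hV ▸ ⟨x, ⟨hxS, hxy ▸ hyz⟩, rfl⟩)
      have hx2 := hSa x hxS
      have hb2 := hSa b hbS
      have := hSO x hxS (σ * (y i - x i)) (by linarith) (by linarith)
      rwa [← mul_assoc, hσ2, one_mul, ← eq_add_single_of_dropCoord_eq hxy.symm] at this
    · refine dist_lt_of_coord_le hr fun k => ?_
      rcases Fin.eq_self_or_eq_succAbove i k with rfl | ⟨j, rfl⟩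
      · have h1 : dist (y k) (b k) = |σ * y k - σ * b k| := by
          rw [← mul_sub, abs_mul, hσa, one_mul, Real.dist_eq]
        rw [h1, abs_le]
        constructor <;> linarith
      · calc dist (y (i.succAbove j)) (b (i.succAbove j)) ≤ dist (dropCoord i y) (dropCoord i b) :=
              dist_le_pi_dist (dropCoord i y) (dropCoord i b) j
          _ ≤ dist (dropCoord i y) z + dist (dropCoord i b) z := dist_triangle_right _ _ _
          _ ≤ 2 * r := by
              rw [mem_closedBall] at hyz hbz
              linarith
  have hL : 0 < 2 * ((n : ℝ) + 2) * r := by positivity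
  have hchain : ENNReal.ofReal (r / 2) * volume (dropCoord i '' S ∩ closedBall z r) ≤
      4⁻¹ * ENNReal.ofReal (r ^ (n + 1)) := by
    calc ENNReal.ofReal (r / 2) * volume (dropCoord i '' S ∩ closedBall z r)
        = volume (splitCoord n i ⁻¹' (I ×ˢ (dropCoord i '' S ∩ closedBall z r))) := by
          rw [(measurePreserving_splitCoord i).measure_preimage_equiv, Measure.volume_eq_prod,
            Measure.prod_prod, hI]
      _ ≤ volume (O ∩ ball b (2 * (n + 2) * r)) := measure_mono hsub
      _ ≤ volume (F ∩ ball b (2 * (n + 2) * r) ∪ O \ F) := by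
          refine measure_mono fun y hy => ?_
          by_cases hyF : y ∈ F
          · exact Or.inl ⟨hyF, hy.2⟩
          · exact Or.inr ⟨hy.1, hyF⟩
      _ ≤ volume (F ∩ ball b (2 * (n + 2) * r)) := by
          refine (measure_union_le _ _).trans ?_
          rw [hOF, add_zero]
      _ ≤ ε * volume (ball b (2 * (n + 2) * r)) := hSF hbS _ hL hrh
      _ = ε * (ENNReal.ofReal ((2 * (n + 2)) ^ (n + 1)) * volume (ball (0 : Pt (n + 1)) 1)) *
            ENNReal.ofReal (r ^ (n + 1)) := by
          rw [Measure.addHaar_ball_of_pos _ _ hL, finrank_euclideanSpace_fin, mul_pow _ r,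
            ENNReal.ofReal_mul (by positivity)]
          ring
      _ ≤ 4⁻¹ * ENNReal.ofReal (r ^ (n + 1)) := by
          gcongr
          exact hε.2.2
  have hcb : ENNReal.ofReal (r ^ n) ≤ volume (closedBall z r) := by
    rw [Real.volume_pi_closedBall z hr.le, Fintype.card_fin]
    exact ENNReal.ofReal_le_ofReal (by gcongr; linarith)
  have hr0 : ENNReal.ofReal (r / 2) ≠ 0 := by
    rw [Ne, ENNReal.ofReal_eq_zero]
    linarith
  rw [← ENNReal.mul_le_mul_iff_right hr0 ENNReal.ofReal_ne_top]
  refine hchain.trans ?_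
  calc (4⁻¹ : ENNReal) * ENNReal.ofReal (r ^ (n + 1))
      = ENNReal.ofReal (4⁻¹ * r ^ (n + 1)) := by
        rw [ENNReal.ofReal_mul (by norm_num), ENNReal.ofReal_inv_of_pos (by norm_num)]
        norm_num
    _ = ENNReal.ofReal (r / 2 * (2⁻¹ * r ^ n)) := by
        congr 1
        ring
    _ = ENNReal.ofReal (r / 2) * (2⁻¹ * ENNReal.ofReal (r ^ n)) := by
        rw [ENNReal.ofReal_mul (by positivity), ENNReal.ofReal_mul (by norm_num),
          ENNReal.ofReal_inv_of_pos (by norm_num)]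
        norm_num
    _ ≤ _ := by gcongr

theorem volume_image_dropCoord_eq_zero {n : ℕ} (i : Fin (n + 1)) {O F : Set (Pt (n + 1))}
    (hOF : volume (O \ F) = 0) {ε : ENNReal} (hε : IsThreshold n ε) {σ : ℝ}
    (hσ : σ = 1 ∨ σ = -1) {h : ℝ} (hh : 0 < h) :
    volume (dropCoord i '' {x | x ∈ smallDensity F ε h ∧
      ∀ s, 0 < s → s < h → x + EuclideanSpace.single i (σ * s) ∈ O}) = 0 := by
  obtain ⟨S, hS⟩ : ∃ S, S = {x | x ∈ smallDensity F ε h ∧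
      ∀ s, 0 < s → s < h → x + EuclideanSpace.single i (σ * s) ∈ O} := ⟨_, rfl⟩
  rw [← hS]
  have hcov : S ⊆ ⋃ j : ℤ, {x | x ∈ S ∧ j * (h / 3) ≤ σ * x i ∧ σ * x i ≤ j * (h / 3) + h / 3} := by
    intro x hx
    have h3 : 0 < h / 3 := by positivity
    refine mem_iUnion.2 ⟨⌊σ * x i / (h / 3)⌋, hx, ?_, ?_⟩
    · rw [← le_div_iff₀ h3]
      exact Int.floor_le _
    · have := (Int.lt_floor_add_one (σ * x i / (h / 3))).le
      rw [div_le_iff₀ h3] at this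
      linarith
  refine measure_mono_null (image_mono hcov) ?_
  rw [image_iUnion, measure_iUnion_null_iff]
  intro j
  refine volume_eq_zero_of_inter_closedBall_le (η := h / (2 * (n + 2))) (by positivity)
    fun z r hr hrh => ?_
  refine volume_inter_closedBall_le_of_slab (h := h) (a := j * (h / 3)) i hOF hε hσ ?_ ?_ ?_ z hr ?_
  · rintro x ⟨hx, -⟩
    rw [hS] at hx
    exact hx.1
  · rintro x ⟨hx, -⟩
    rw [hS] at hx
    exact hx.2
  · exact fun x hx => hx.2
  · rwa [lt_div_iff₀' (by positivity)] at hrh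

theorem single_eq_smul (i : Fin N) (t : ℝ) :
    (EuclideanSpace.single i t : Pt N) = t • EuclideanSpace.single i 1 := by
  ext k
  by_cases h : k = i <;> simp [h]

theorem disjoint_densZero_compl {E : Set (Pt N)} (hE : MeasurableSet E) :
    Disjoint (densZero E) (densZero Eᶜ) := by
  rw [Set.disjoint_left]
  intro x h1 h2
  exact zero_ne_one (tendsto_nhds_unique h1 ((densTendsto_one_iff hE x).2 h2))

/-- The projections of the points of density `1` are almost everywhere projections of points of the
essential boundary. -/
theorem volume_image_dropCoord_diff_essBdry {n : ℕ} (i : Fin (n + 1)) {E : Set (Pt (n + 1))}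
    (hE : MeasurableSet E)
    (hfar : ∀ p, ∃ s, p + EuclideanSpace.single i s ∈ densZero E) :
    volume (dropCoord i '' densZero Eᶜ \ dropCoord i '' essBdry E) = 0 := by
  obtain ⟨ε, hε⟩ := exists_isThreshold n
  let B : Set (Pt (n + 1)) → ℝ → ℕ → Set (Fin n → ℝ) := fun F σ k =>
    dropCoord i '' {x | x ∈ smallDensity F ε (1 / ((k : ℝ) + 1)) ∧
      ∀ s, 0 < s → s < 1 / ((k : ℝ) + 1) → x + EuclideanSpace.single i (σ * s) ∈ densZero Fᶜ}
  have hB : ∀ F, MeasurableSet F → ∀ σ : ℝ, (σ = 1 ∨ σ = -1) → ∀ k, volume (B F σ k) = 0 := by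
    intro F hF σ hσ k
    refine volume_image_dropCoord_eq_zero i ?_ hε hσ (by positivity)
    rw [sdiff_eq, volume_densZero_inter hF.compl]
  have hnull : volume (⋃ k, B E 1 k ∪ B E (-1) k ∪ (B Eᶜ 1 k ∪ B Eᶜ (-1) k)) = 0 := by
    refine measure_iUnion_null fun k => ?_
    refine measure_union_null (measure_union_null ?_ ?_) (measure_union_null ?_ ?_)
    · exact hB E hE 1 (Or.inl rfl) k
    · exact hB E hE (-1) (Or.inr rfl) k
    · exact hB Eᶜ hE.compl 1 (Or.inl rfl) k
    · exact hB Eᶜ hE.compl (-1) (Or.inr rfl) k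
  refine measure_mono_null ?_ hnull
  rintro _ ⟨⟨p, hp, rfl⟩, hpe⟩
  have hγ : Continuous fun t : ℝ => p + EuclideanSpace.single i t := by
    have h : Continuous fun t : ℝ => t • (EuclideanSpace.single i 1 : Pt (n + 1)) := by fun_prop
    exact continuous_const.add (h.congr fun t => (single_eq_smul i t).symm)
  have hγadd : ∀ t s : ℝ, p + EuclideanSpace.single i (t + s) =
      p + EuclideanSpace.single i t + EuclideanSpace.single i s := fun t s => by
    rw [single_eq_smul i (t + s), single_eq_smul i t, single_eq_smul i s, add_smul, add_assoc]
  have hdich : ∀ t : ℝ, p + EuclideanSpace.single i t ∉ densZero Eᶜ ↔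
      p + EuclideanSpace.single i t ∈ densZero E := by
    intro t
    constructor
    · intro h
      by_contra h'
      refine hpe ⟨p + EuclideanSpace.single i t, ?_, dropCoord_add_single i p t⟩
      rw [essBdry_eq_compl hE]
      exact fun h'' => h''.elim h' h
    · exact fun h => Set.disjoint_left.1 (disjoint_densZero_compl hE) h
  have hunion : ∀ F, MeasurableSet F →
      (∀ t : ℝ, p + EuclideanSpace.single i t ∉ densZero Fᶜ →
        p + EuclideanSpace.single i t ∈ densZero F) →
      {t : ℝ | p + EuclideanSpace.single i t ∈ densZero F} =
        ⋃ k : ℕ, {t : ℝ | p + EuclideanSpace.single i t ∈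
          smallDensity F ε (1 / ((k : ℝ) + 1))} := by
    intro F hF hd
    ext t
    rw [mem_iUnion]
    constructor
    · intro ht
      obtain ⟨k, -, hk⟩ := exists_mem_smallDensity ht hε.1 one_pos
      exact ⟨k, hk⟩
    · rintro ⟨k, hk⟩
      exact hd t (notMem_densZero_compl_of_mem_smallDensity hF hε.2.1 (by positivity) hk)
  obtain ⟨σ, hσ, t, δ, hδ, h⟩ := exists_one_sided_transition
    (A := {t : ℝ | p + EuclideanSpace.single i t ∈ densZero Eᶜ})
    (fun k : ℕ => (isClosed_smallDensity Eᶜ ε (1 / ((k : ℝ) + 1))).preimage hγ)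
    (fun k : ℕ => (isClosed_smallDensity E ε (1 / ((k : ℝ) + 1))).preimage hγ)
    (hunion Eᶜ hE.compl fun t ht => by
      rw [compl_compl] at ht
      by_contra h
      exact ht ((hdich t).1 h))
    (by
      refine Eq.trans ?_ (hunion E hE fun t ht => (hdich t).1 ht)
      ext t
      exact hdich t)
    ⟨0, by simpa [single_eq_smul i 0] using hp⟩
    (by
      obtain ⟨s, hs⟩ := hfar p
      exact ⟨s, (hdich s).2 hs⟩)
  have hmem : ∀ F, p + EuclideanSpace.single i t ∈ densZero F →
      (∀ s, 0 < s → s < δ → p + EuclideanSpace.single i (t + σ * s) ∈ densZero Fᶜ) →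
      ∃ k, dropCoord i p ∈ B F σ k := by
    intro F hF hs
    obtain ⟨k, hk, hk'⟩ := exists_mem_smallDensity hF hε.1 hδ
    refine ⟨k, p + EuclideanSpace.single i t, ⟨hk', fun s h0 h1 => ?_⟩, dropCoord_add_single i p t⟩
    rw [← hγadd]
    exact hs s h0 (h1.trans hk)
  rw [mem_iUnion]
  rcases h with ⟨ht, hs⟩ | ⟨ht, hs⟩
  · obtain ⟨k, hk⟩ := hmem Eᶜ ht fun s h0 h1 => by
      rw [compl_compl]
      exact (hdich _).1 (hs s h0 h1)
    refine ⟨k, Or.inr ?_⟩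
    rcases hσ with rfl | rfl
    · exact Or.inl hk
    · exact Or.inr hk
  · obtain ⟨k, hk⟩ := hmem E ((hdich t).1 ht) hs
    refine ⟨k, Or.inl ?_⟩
    rcases hσ with rfl | rfl
    · exact Or.inl hk
    · exact Or.inr hk

/-- A form of the Loomis–Whitney inequality. -/
theorem volume_pow_le_sum_volume_projections {n : ℕ} (hn : 1 ≤ n) {A : Set (Fin (n + 1) → ℝ)}
    (hAm : MeasurableSet A)    {Z : Fin (n + 1) → Set (Fin n → ℝ)} (hA : ∀ x ∈ A, ∀ i, i.removeNth x ∈ Z i) :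
    volume A ^ n ≤ (∑ i, volume (Z i)) ^ (n + 1) := by
  have hn0 : (0 : ℝ) < n := by exact_mod_cast hn
  let W : Fin (n + 1) → Set (Fin n → ℝ) := fun i => toMeasurable volume (Z i)
  let C : Fin (n + 1) → Set (Fin (n + 1) → ℝ) := fun i =>
    MeasurableEquiv.piFinSuccAbove (fun _ => ℝ) i ⁻¹' (Ioo 0 1 ×ˢ W i)
  have hC : ∀ i, MeasurableSet (C i) := fun i =>
    (MeasurableEquiv.measurable _) (measurableSet_Ioo.prod (measurableSet_toMeasurable _ _))
  let f : (Fin (n + 1) → ℝ) → ENNReal := fun x => ∑ i, (C i).indicator 1 x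
  have hf : Measurable f :=
    Finset.measurable_sum _ fun i _ => measurable_one.indicator (hC i)
  have hint : ∫⁻ x, f x = ∑ i, volume (Z i) := by
    rw [lintegral_finsetSum _ fun i _ => measurable_one.indicator (hC i)]
    refine Finset.sum_congr rfl fun i _ => ?_
    rw [lintegral_indicator_one (hC i),
      (volume_preserving_piFinSuccAbove (fun _ => ℝ) i).measure_preimage_equiv,
      Measure.volume_eq_prod, Measure.prod_prod]
    simp only [W, Real.volume_Ioo, sub_zero, ENNReal.ofReal_one, one_mul]
    exact measure_toMeasurable _
  have hline : ∀ x ∈ A, ∀ i, 1 ≤ ∫⁻ u : ℝ, f (Function.update x i u) := by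
    intro x hx i
    have h1 : volume (Ioo (0 : ℝ) 1) = 1 := by simp
    rw [← h1, ← lintegral_indicator_one measurableSet_Ioo]
    refine lintegral_mono fun u => ?_
    by_cases hu : u ∈ Ioo (0 : ℝ) 1
    swap
    · rw [indicator_of_notMem hu]
      exact zero_le
    rw [indicator_of_mem hu]
    refine le_trans ?_ (Finset.single_le_sum
      (f := fun i' => (C i').indicator (1 : (Fin (n + 1) → ℝ) → ENNReal) (Function.update x i u))
      (fun _ _ => zero_le) (Finset.mem_univ i))
    have hmem : Function.update x i u ∈ C i := by
      refine ⟨?_, ?_⟩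
      · change Function.update x i u i ∈ Ioo (0 : ℝ) 1
        rwa [Function.update_self]
      · refine subset_toMeasurable _ _ ?_
        have := hA x hx i
        rw [← Fin.removeNth_update i u x] at this
        exact this
    simp [indicator_of_mem hmem]
  have hp : Real.HolderConjugate (Fintype.card (Fin (n + 1)) : ℝ) ((n + 1) / n) := by
    rw [Fintype.card_fin, Real.holderConjugate_iff]
    push_cast
    refine ⟨by linarith, ?_⟩
    field_simp
    ring
  have hgrid := lintegral_prod_lintegral_pow_le (fun _ : Fin (n + 1) => (volume : Measure ℝ)) hp hf
  have hvol : volume A ≤ (∑ i, volume (Z i)) ^ (((n : ℝ) + 1) / n) := by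
    rw [← hint]
    refine le_trans ?_ hgrid
    rw [← volume_pi, ← setLIntegral_one A]
    refine (setLIntegral_mono' hAm fun x hx => ?_).trans (setLIntegral_le_lintegral A _)
    refine Finset.one_le_prod' fun i _ => ENNReal.one_le_rpow (hline x hx i) ?_
    rw [Fintype.card_fin]
    push_cast
    rw [add_sub_cancel_right]
    positivity
  calc volume A ^ n ≤ ((∑ i, volume (Z i)) ^ (((n : ℝ) + 1) / n)) ^ n := by gcongr
    _ = (∑ i, volume (Z i)) ^ (n + 1) := by
      rw [← ENNReal.rpow_natCast, ← ENNReal.rpow_mul, div_mul_cancel₀ _ hn0.ne',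
        ← Nat.cast_add_one, ENNReal.rpow_natCast]

/-- An isoperimetric inequality with a dimensional constant. -/
theorem volume_pow_le_hausdorffMeasure_essBdry {n : ℕ} (hn : 1 ≤ n) {E : Set (Pt (n + 1))}
    (hE : MeasurableSet E) (hbd : Bornology.IsBounded E) :
    volume E ^ n ≤ ((n + 1) * μH[(n : ℝ)] (essBdry E)) ^ (n + 1) := by
  have hfar : ∀ (i : Fin (n + 1)) (p : Pt (n + 1)), ∃ s,
      p + EuclideanSpace.single i s ∈ densZero E := by
    intro i p
    obtain ⟨R, hR⟩ := hbd.subset_ball p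
    have hR' : E ⊆ ball p (max R 0) := hR.trans (ball_subset_ball (le_max_left _ _))
    refine ⟨max R 0 + 1, tendsto_const_nhds.congr' ?_⟩
    filter_upwards [Ioo_mem_nhdsGT one_pos] with r hr
    have he : E ∩ ball (p + EuclideanSpace.single i (max R 0 + 1)) r = ∅ := by
      rw [← disjoint_iff_inter_eq_empty]
      refine (ball_disjoint_ball ?_).mono_left hR'
      rw [dist_self_add_right, PiLp.norm_single, Real.norm_eq_abs,
        abs_of_nonneg (by positivity)]
      linarith [hr.2]
    rw [he, measure_empty, ENNReal.zero_div]
  let e := MeasurableEquiv.toLp 2 (Fin (n + 1) → ℝ)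
  let E' : Set (Pt (n + 1)) := E \ toMeasurable volume (E \ densZero Eᶜ)
  have hE' : MeasurableSet E' := hE.diff (measurableSet_toMeasurable _ _)
  have hsub : E' ⊆ densZero Eᶜ := by
    rintro x ⟨hx, hx'⟩
    by_contra h
    exact hx' (subset_toMeasurable _ _ ⟨hx, h⟩)
  have hvol : volume (e ⁻¹' E') = volume E := by
    have hpre : volume (e ⁻¹' E') = volume E' :=
      (PiLp.volume_preserving_toLp (Fin (n + 1))).measure_preimage hE'.nullMeasurableSet
    rw [hpre]
    refine measure_sdiff_null ?_
    rw [measure_toMeasurable, volume_diff_densZero_compl hE]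
  have hLW := volume_pow_le_sum_volume_projections hn (e.measurable hE')
    (Z := fun i => dropCoord i '' densZero Eᶜ)
    fun x hx i => ⟨e x, hsub hx, rfl⟩
  rw [hvol] at hLW
  refine hLW.trans (pow_le_pow_left' ?_ _)
  calc ∑ i, volume (dropCoord i '' densZero Eᶜ)
      ≤ ∑ _i : Fin (n + 1), μH[(n : ℝ)] (essBdry E) := by
        refine Finset.sum_le_sum fun i _ => ?_
        refine le_trans ?_ (volume_image_dropCoord_le i (essBdry E))
        exact measure_mono_ae (ae_le_set.2 (volume_image_dropCoord_diff_essBdry i hE (hfar i)))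
    _ = (n + 1) * μH[(n : ℝ)] (essBdry E) := by simp

theorem exists_hausdorffMeasure_le_mul_volume (N : ℕ) :
    ∃ C : ℝ, 0 < C ∧ ∀ A : Set (Pt N), μH[(N : ℝ)] A ≤ ENNReal.ofReal C * volume A := by
  let e := (EuclideanSpace.equiv (Fin N) ℝ).symm
  obtain ⟨K, hK⟩ : ∃ K : NNReal, LipschitzWith K e := ⟨_, e.lipschitz⟩
  refine ⟨(K : ℝ) ^ N + 1, by positivity, fun A => ?_⟩
  have h := hK.hausdorffMeasure_image_le (Nat.cast_nonneg N) (e ⁻¹' A)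
  have h2 := hausdorffMeasure_pi_real (ι := Fin N)
  rw [Fintype.card_fin] at h2
  have hpre : volume (e ⁻¹' A) = volume A :=
    (PiLp.volume_preserving_toLp (Fin N)).measure_preimage_equiv
      (f := MeasurableEquiv.toLp 2 (Fin N → ℝ)) A
  rw [image_preimage_eq _ e.surjective, h2, hpre, ENNReal.rpow_natCast] at h
  refine h.trans ?_
  gcongr
  rw [ENNReal.ofReal_add (by positivity) zero_le_one, ENNReal.ofReal_pow (by positivity),
    ENNReal.ofReal_coe_nnreal]
  exact le_self_add

/-- The `n`-dimensional measures of the spherical slices of `G ∪ ∂ᵉG` in an annulus are controlled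
by the volume of `G` in the annulus. -/
theorem exists_measurable_majorant_sphere {n : ℕ} {C : ℝ}
    (hC : ∀ A : Set (Pt (n + 1)), μH[((n + 1 : ℕ) : ℝ)] A ≤ ENNReal.ofReal C * volume A)
    (hn : 1 ≤ n) {G : Set (Pt (n + 1))} (hper : μH[(n : ℝ)] (essBdry G) < ⊤) (x : Pt (n + 1))
    (a b : ℝ) :
    ∃ g : ℝ → ENNReal, Measurable g ∧
      (∀ t, a ≤ t → t < b → μH[(n : ℝ)] (sphere x t ∩ (G ∪ essBdry G)) ≤ g t) ∧
      ∫⁻ t, g t ≤ ENNReal.ofReal C * volume (G ∩ (ball x b \ ball x a)) := by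
  have hn0 : (0 : ℝ) < n := by exact_mod_cast hn
  obtain ⟨g, hgm, hg, hgi⟩ := exists_measurable_majorant_hausdorffMeasure_slice
    (f := fun y : Pt (n + 1) => dist y x) (LipschitzWith.dist_left x) hn0
    ((G ∪ essBdry G) ∩ (ball x b \ ball x a))
  refine ⟨g, hgm, fun t hat htb => ?_, hgi.trans ?_⟩
  · refine le_trans (measure_mono ?_) (hg t)
    rintro y ⟨hy, hyG⟩
    rw [mem_sphere] at hy
    refine ⟨⟨hyG, ?_, ?_⟩, hy⟩
    · rwa [mem_ball, hy]
    · rwa [mem_ball, hy, not_lt]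
  · have hz : μH[(n : ℝ) + 1] (essBdry G) = 0 :=
      (Measure.hausdorffMeasure_zero_or_top (by linarith : (n : ℝ) < n + 1) _).resolve_right hper.ne
    rw [← Nat.cast_add_one] at hz ⊢
    refine le_trans ?_ (hC _)
    rw [union_inter_distrib_right]
    refine (measure_union_le _ _).trans ?_
    rw [measure_mono_null inter_subset_left hz, add_zero]

/-- If the spheres meet `G ∪ ∂ᵉG` in a large set at all small radii, then the volume of `G` in small
balls is bounded below by a power of the radius. -/
theorem exists_le_mul_of_forall_sphere_gt {n : ℕ} (hn : 1 ≤ n) {G : Set (Pt (n + 1))}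
    (hG : MeasurableSet G) (hper : μH[(n : ℝ)] (essBdry G) < ⊤) (x : Pt (n + 1)) {H r₀ : ℝ}
    (hH : 0 < H)
    (hbig : ∀ r, 0 < r → r ≤ r₀ → ENNReal.ofReal (1 / H) * μH[(n : ℝ)] (essBdry (G ∩ ball x r)) <
      μH[(n : ℝ)] (sphere x r ∩ (G ∪ essBdry G))) :
    ∃ κ : ℝ, 0 < κ ∧ ∀ r, 0 < r → r ≤ r₀ →
      ENNReal.ofReal (κ * r ^ (n + 1)) ≤ volume (G ∩ ball x r) := by
  obtain ⟨C, hC0, hC⟩ := exists_hausdorffMeasure_le_mul_volume (n + 1)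
  have hfin : ∀ r, volume (G ∩ ball x r) ≠ ⊤ := fun r =>
    ((measure_mono inter_subset_right).trans_lt measure_ball_lt_top).ne
  have hmono : Monotone fun r => volume (G ∩ ball x r) := fun r s hrs =>
    measure_mono (inter_subset_inter_right _ (ball_subset_ball hrs))
  obtain ⟨v, hv⟩ : ∃ v : ℝ → ℝ,
      v = fun r => (volume (G ∩ ball x r)).toReal ^ (1 / ((n : ℝ) + 1)) := ⟨_, rfl⟩
  have hv0 : ∀ r, 0 ≤ v r := fun r => hv ▸ Real.rpow_nonneg ENNReal.toReal_nonneg _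
  have hvpow : ∀ r, v r ^ (n + 1) = (volume (G ∩ ball x r)).toReal := fun r => by
    rw [hv, ← Real.rpow_natCast, ← Real.rpow_mul ENNReal.toReal_nonneg]
    push_cast
    rw [one_div_mul_cancel (by positivity), Real.rpow_one]
  have hvol : ∀ r, ENNReal.ofReal (v r) ^ (n + 1) = volume (G ∩ ball x r) := fun r => by
    rw [← ENNReal.ofReal_pow (hv0 r), hvpow, ENNReal.ofReal_toReal (hfin r)]
  have hvmono : Monotone v := fun r s hrs => by
    rw [hv]
    exact Real.rpow_le_rpow ENNReal.toReal_nonneg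
      (ENNReal.toReal_mono (hfin s) (hmono hrs)) (by positivity)
  have hiso : ∀ r, ENNReal.ofReal (v r) ^ n ≤
      (n + 1) * μH[(n : ℝ)] (essBdry (G ∩ ball x r)) := by
    intro r
    have h := volume_pow_le_hausdorffMeasure_essBdry hn (hG.inter measurableSet_ball)
      (isBounded_ball.subset (inter_subset_right : G ∩ ball x r ⊆ ball x r))
    rw [← hvol, ← pow_mul, mul_comm, pow_mul] at h
    exact (ENNReal.pow_le_pow_left_iff n.succ_ne_zero).1 h
  have hvpos : ∀ r ∈ Ioc 0 r₀, 0 < v r := by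
    intro r hr
    by_contra hcon
    have hvr : v r = 0 := le_antisymm (not_lt.1 hcon) (hv0 r)
    have hzero : volume (G ∩ ball x r) = 0 := by
      rw [← hvol, hvr]
      simp
    obtain ⟨g, hgm, hg, hgi⟩ := exists_measurable_majorant_sphere hC hn hper x 0 r
    rw [ball_zero, sdiff_empty, hzero, mul_zero, nonpos_iff_eq_zero, lintegral_eq_zero_iff hgm]
      at hgi
    have hnull : volume (Ioo 0 r) = 0 := by
      refine measure_mono_null (fun t ht => ?_) (ae_iff.1 hgi)
      refine (lt_of_le_of_lt zero_le (lt_of_lt_of_le (hbig t ht.1 (ht.2.le.trans hr.2))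
        (hg t ht.1.le ht.2))).ne'
    rw [Real.volume_Ioo, sub_zero, ENNReal.ofReal_eq_zero] at hnull
    exact hr.1.not_ge hnull
  have hgrowth : ∀ a b, 0 < a → a < b → b ≤ r₀ →
      v a ^ (n + 1) + 1 / (H * ((n + 1) * C)) * (b - a) * v a ^ n ≤ v b ^ (n + 1) := by
    intro a b ha hab hb
    obtain ⟨g, hgm, hg, hgi⟩ := exists_measurable_majorant_sphere hC hn hper x a b
    have hpt : ∀ t ∈ Ioo a b, ENNReal.ofReal (1 / H) * ENNReal.ofReal (v a) ^ n ≤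
        (n + 1) * g t := by
      intro t ht
      calc ENNReal.ofReal (1 / H) * ENNReal.ofReal (v a) ^ n
          ≤ ENNReal.ofReal (1 / H) * ENNReal.ofReal (v t) ^ n := by
            gcongr
            exact hvmono ht.1.le
        _ ≤ ENNReal.ofReal (1 / H) * ((n + 1) * μH[(n : ℝ)] (essBdry (G ∩ ball x t))) := by
            gcongr
            exact hiso t
        _ = (n + 1) * (ENNReal.ofReal (1 / H) * μH[(n : ℝ)] (essBdry (G ∩ ball x t))) := by ring
        _ ≤ (n + 1) * g t := by
            gcongr
            exact (hbig t (ha.trans ht.1) (ht.2.le.trans hb)).le.trans (hg t ht.1.le ht.2)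
    have hint : ENNReal.ofReal (1 / H) * ENNReal.ofReal (v a) ^ n * ENNReal.ofReal (b - a) ≤
        (n + 1) * (ENNReal.ofReal C * volume (G ∩ (ball x b \ ball x a))) := by
      rw [← Real.volume_Ioo, ← setLIntegral_const]
      refine (setLIntegral_mono' measurableSet_Ioo hpt).trans ?_
      refine (setLIntegral_le_lintegral _ _).trans ?_
      rw [lintegral_const_mul _ hgm]
      gcongr
    have hsplit : volume (G ∩ (ball x b \ ball x a)) + volume (G ∩ ball x a) =
        volume (G ∩ ball x b) := by
      rw [← measure_inter_add_sdiff (G ∩ ball x b) (measurableSet_ball (x := x) (ε := a)),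
        add_comm, inter_assoc, inter_eq_self_of_subset_right (ball_subset_ball hab.le),
        inter_sdiff_assoc]
    have hne : volume (G ∩ (ball x b \ ball x a)) ≠ ⊤ := by
      refine ne_top_of_le_ne_top (hfin b) ?_
      rw [← hsplit]
      exact le_self_add
    have hreal := ENNReal.toReal_mono (by finiteness) hint
    have hsplit' := congrArg ENNReal.toReal hsplit
    rw [ENNReal.toReal_add hne (hfin a), ← hvpow, ← hvpow] at hsplit'
    simp only [ENNReal.toReal_mul, ENNReal.toReal_pow, ENNReal.toReal_ofReal (hv0 a),
      ENNReal.toReal_ofReal hC0.le, ENNReal.toReal_ofReal (sub_nonneg.2 hab.le),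
      ENNReal.toReal_ofReal (one_div_pos.2 hH).le] at hreal
    rw [show ((n : ENNReal) + 1).toReal = n + 1 by
      rw [← Nat.cast_add_one, ENNReal.toReal_natCast, Nat.cast_add_one]] at hreal
    have hD : 0 < ((n : ℝ) + 1) * C := by positivity
    have h1 : 1 / (H * ((n + 1) * C)) * (b - a) * v a ^ n =
        (1 / H * v a ^ n * (b - a)) / ((n + 1) * C) := by
      field_simp
    have h2 : (1 / H * v a ^ n * (b - a)) / ((n + 1) * C) ≤
        (volume (G ∩ (ball x b \ ball x a))).toReal := by
      rw [div_le_iff₀' hD, mul_assoc (_ + _)]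
      exact hreal
    linarith
  have hc : 0 < 1 / (H * ((n + 1) * C)) := by positivity
  have hlow := le_mul_of_pow_growth hc n (hvmono.monotoneOn _) hvpos hgrowth
  obtain ⟨K, hK⟩ : ∃ K : ℝ, K = 2 ^ (n + 2) / (1 / (H * ((n + 1) * C))) := ⟨_, rfl⟩
  have hK0 : 0 < K := by rw [hK]; positivity
  rw [← hK] at hlow
  refine ⟨(K ^ (n + 1))⁻¹, by positivity, fun r hr hr₀ => ?_⟩
  rw [← hvol, ← ENNReal.ofReal_pow (hv0 r)]
  refine ENNReal.ofReal_le_ofReal ?_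
  rw [inv_mul_le_iff₀ (by positivity), ← mul_pow]
  exact pow_le_pow_left₀ hr.le (hlow r ⟨hr, hr₀⟩) _

/-- Lemma 3.1 of the paper: around a point of density `0` of `G` one can find
arbitrarily small radii `r` for which the sphere `∂B(x,r)` meets `G ∪ ∂^e G` in small
`H^{N−1}` measure compared with the perimeter of `G ∩ B(x,r)`. -/
theorem good_radius_selection (N : ℕ) (hN : 2 ≤ N)
    (G : Set (Pt N)) (hG : MeasurableSet G)
    (hper : μH[(N : ℝ) - 1] (essBdry G) < ⊤)
    (x : Pt N) (hx : densTendsto G x 0)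
    (H : ℝ) (hH : 0 < H) :
    ∀ r₀ : ℝ, 0 < r₀ → ∃ r : ℝ, 0 < r ∧ r ≤ r₀ ∧
      μH[(N : ℝ) - 1] (sphere x r ∩ (G ∪ essBdry G)) ≤
        ENNReal.ofReal (1 / H) * μH[(N : ℝ) - 1] (essBdry (G ∩ ball x r)) := by
  obtain ⟨n, rfl⟩ : ∃ n, N = n + 1 := ⟨N - 1, by omega⟩
  have hn : 1 ≤ n := by omega
  have hcast : ((n + 1 : ℕ) : ℝ) - 1 = n := by
    push_cast
    ring
  rw [hcast] at hper ⊢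
  intro r₀ hr₀
  by_contra! hcon
  obtain ⟨κ, hκ, hlow⟩ := exists_le_mul_of_forall_sphere_gt hn hG hper x hH hcon
  have hω : volume (ball (0 : Pt (n + 1)) 1) ≠ 0 := (measure_ball_pos _ _ one_pos).ne'
  have hω' : volume (ball (0 : Pt (n + 1)) 1) ≠ ⊤ := measure_ball_lt_top.ne
  have hev : ∀ᶠ r in nhdsWithin (0 : ℝ) (Ioi 0),
      ENNReal.ofReal κ / volume (ball (0 : Pt (n + 1)) 1) ≤
        volume (G ∩ ball x r) / volume (ball x r) := by
    filter_upwards [Ioo_mem_nhdsGT hr₀] with r hr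
    rw [ENNReal.le_div_iff_mul_le (Or.inl (measure_ball_pos _ _ hr.1).ne')
      (Or.inl measure_ball_lt_top.ne)]
    refine le_trans (le_of_eq ?_) (hlow r hr.1 hr.2.le)
    rw [Measure.addHaar_ball_of_pos _ _ hr.1, finrank_euclideanSpace_fin,
      ENNReal.ofReal_mul hκ.le, mul_comm (ENNReal.ofReal (r ^ (n + 1))), ← mul_assoc,
      ENNReal.div_mul_cancel hω hω']
  have h0 := ge_of_tendsto hx hev
  exact (ENNReal.div_pos (ENNReal.ofReal_pos.2 hκ).ne' hω').not_ge h0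
end
end

section
/- Let N ≥ 1 be an integer, let 0 ≤ a < b be real numbers, let c ≥ 0, and let m : [a,b] → ℝ be a nondecreasing function with m(t) > 0 for every t ∈ [a,b]. Assume that for almost every t ∈ (a,b) the function m is differentiable at t with m'(t) ≥ c · m(t)^{(N−1)/N}. Then m(b)^{1/N} ≥ m(a)^{1/N} + (c/N)(b − a). -/
open MeasureTheory Set

/-- A monotone function whose derivative is almost everywhere at least `k` grows at least
linearly with slope `k`. -/
theorem MonotoneOn.mul_sub_le_of_ae_le_deriv {f : ℝ → ℝ} {a b k : ℝ} (hab : a ≤ b)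
    (hf : MonotoneOn f (Icc a b)) (hk : ∀ᵐ t ∂(volume.restrict (Ioo a b)), k ≤ deriv f t) :
    k * (b - a) ≤ f b - f a := by
  have hf' : MonotoneOn f (uIcc a b) := by rwa [uIcc_of_le hab]
  have hle : ∫ _ in a..b, k ≤ ∫ t in a..b, deriv f t := by
    refine intervalIntegral.integral_mono_ae_restrict hab intervalIntegrable_const
      hf'.intervalIntegrable_deriv ?_
    rwa [restrict_Ioo_eq_restrict_Icc] at hk
  have hmem := hf'.intervalIntegral_deriv_mem_uIcc
  rw [uIcc_of_le (sub_nonneg.2 (hf (left_mem_Icc.2 hab) (right_mem_Icc.2 hab) hab))] at hmem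
  rw [intervalIntegral.integral_const, smul_eq_mul, mul_comm] at hle
  exact hle.trans hmem.2

/-- the differential-inequality argument underlying Lemma 3.1: if `m` is
nondecreasing and positive on `[a,b]` and `m' ≥ c m^{(N−1)/N}` almost everywhere, then
`m(b)^{1/N} ≥ m(a)^{1/N} + (c/N)(b − a)`. -/
theorem power_growth_of_deriv_ineq (N : ℕ) (hN : 1 ≤ N)
    (a b c : ℝ) (ha : 0 ≤ a) (hab : a < b) (hc : 0 ≤ c)
    (m : ℝ → ℝ) (hmono : MonotoneOn m (Icc a b))
    (hpos : ∀ t ∈ Icc a b, 0 < m t)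
    (hderiv : ∀ᵐ t ∂(volume.restrict (Ioo a b)),
      ∃ d : ℝ, HasDerivAt m d t ∧ c * m t ^ (((N : ℝ) - 1) / (N : ℝ)) ≤ d) :
    m a ^ (1 / (N : ℝ)) + (c / (N : ℝ)) * (b - a) ≤ m b ^ (1 / (N : ℝ)) := by
  have hN0 : (0 : ℝ) < N := by exact_mod_cast hN
  have hroot : MonotoneOn (fun t => m t ^ (1 / (N : ℝ))) (Icc a b) := fun s hs t ht hst =>
    Real.rpow_le_rpow (hpos s hs).le (hmono hs ht hst) (by positivity)
  have hgrowth : c / N * (b - a) ≤ m b ^ (1 / (N : ℝ)) - m a ^ (1 / (N : ℝ)) := by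
    refine hroot.mul_sub_le_of_ae_le_deriv hab.le ?_
    filter_upwards [hderiv, ae_restrict_mem measurableSet_Ioo] with t ⟨d, hd, hle⟩ ht
    have hmt := hpos t (Ioo_subset_Icc_self ht)
    rw [(hd.rpow_const (Or.inl hmt.ne')).deriv]
    have hcancel : m t ^ (((N : ℝ) - 1) / N) * m t ^ (1 / (N : ℝ) - 1) = 1 := by
      rw [← Real.rpow_add hmt]
      convert Real.rpow_zero (m t) using 2
      field_simp
      ring
    calc c / N = c * m t ^ (((N : ℝ) - 1) / N) * (1 / N) * m t ^ (1 / (N : ℝ) - 1) := by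
          linear_combination (-(c / N)) * hcancel
      _ ≤ d * (1 / N) * m t ^ (1 / (N : ℝ) - 1) := by gcongr
  linarith
end

section
/- Let N ≥ 1 be an integer, let c > 0 and t₀ ∈ ℝ, and let v : [t₀, ∞) → ℝ be a nonincreasing, nonnegative function. Assume that for almost every t > t₀ at which v(t) > 0, the function v is differentiable at t with v'(t) ≤ −c · v(t)^{(N−1)/N}. Then v(t) = 0 for every t ≥ t₀ + (N/c) · v(t₀)^{1/N}. -/
open MeasureTheory Set

/-- A function that is antitone on `[a, b]` and whose derivative is almost everywhere at most `m`
satisfies `w b - w a ≤ m * (b - a)`. -/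
theorem AntitoneOn.sub_le_mul_of_ae_hasDerivAt_le {w : ℝ → ℝ} {a b m : ℝ} (hab : a ≤ b)
    (hw : AntitoneOn w (Icc a b))
    (hd : ∀ᵐ x ∂(volume.restrict (Icc a b)), ∃ d : ℝ, HasDerivAt w d x ∧ d ≤ m) :
    w b - w a ≤ m * (b - a) := by
  have hneg : MonotoneOn (fun x => -w x) (uIcc a b) := by
    rw [uIcc_of_le hab]
    exact hw.neg
  have hle : -m * (b - a) ≤ ∫ x in a..b, deriv (fun x => -w x) x := by
    calc -m * (b - a) = ∫ _ in a..b, -m := by simp [mul_comm]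
      _ ≤ _ := by
        refine intervalIntegral.integral_mono_ae_restrict hab (by simp)
          hneg.intervalIntegrable_deriv ?_
        filter_upwards [hd] with x ⟨d, hdx, hdm⟩
        rw [hdx.fun_neg.deriv]
        linarith
  have hmem := hneg.intervalIntegral_deriv_mem_uIcc
  have hba : w b ≤ w a := hw (left_mem_Icc.2 hab) (right_mem_Icc.2 hab) hab
  rw [uIcc_of_le (by linarith)] at hmem
  linarith [hmem.2]

/-- the extinction argument of Corollary 1.3: if `v` is nonincreasing,
nonnegative on `[t₀, ∞)` and satisfies `v' ≤ −c v^{(N−1)/N}` a.e. where `v > 0`, then `v`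
vanishes for every `t ≥ t₀ + (N/c) v(t₀)^{1/N}`. -/
theorem extinction_of_deriv_ineq (N : ℕ) (hN : 1 ≤ N)
    (c t₀ : ℝ) (hc : 0 < c)
    (v : ℝ → ℝ) (hmono : AntitoneOn v (Ici t₀))
    (hnn : ∀ t ∈ Ici t₀, 0 ≤ v t)
    (hderiv : ∀ᵐ t ∂(volume.restrict (Ioi t₀)), 0 < v t →
      ∃ d : ℝ, HasDerivAt v d t ∧ d ≤ -c * v t ^ (((N : ℝ) - 1) / (N : ℝ))) :
    ∀ t : ℝ, t₀ + ((N : ℝ) / c) * v t₀ ^ (1 / (N : ℝ)) ≤ t → v t = 0 := by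
  intro t ht
  have hN0 : (0 : ℝ) < N := by exact_mod_cast hN
  have hv₀ : 0 ≤ v t₀ := hnn t₀ self_mem_Ici
  have ht₀ : t₀ ≤ t := le_trans (le_add_of_nonneg_right (by positivity)) ht
  by_contra hne
  have hvt : 0 < v t := lt_of_le_of_ne (hnn t ht₀) (Ne.symm hne)
  have hpos : ∀ x ∈ Icc t₀ t, 0 < v x := fun x hx =>
    hvt.trans_le (hmono hx.1 ht₀ hx.2)
  have hw : AntitoneOn (fun x => v x ^ (1 / (N : ℝ))) (Icc t₀ t) := fun x hx y hy hxy =>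
    Real.rpow_le_rpow (hpos y hy).le (hmono hx.1 hy.1 hxy) (by positivity)
  have hd : ∀ᵐ x ∂(volume.restrict (Icc t₀ t)),
      ∃ d : ℝ, HasDerivAt (fun x => v x ^ (1 / (N : ℝ))) d x ∧ d ≤ -c / N := by
    rw [← restrict_Ioc_eq_restrict_Icc]
    filter_upwards [ae_restrict_of_ae_restrict_of_subset Ioc_subset_Ioi_self hderiv,
      ae_restrict_mem measurableSet_Ioc] with x hx hxt
    have hvx := hpos x ⟨hxt.1.le, hxt.2⟩
    obtain ⟨d, hdx, hle⟩ := hx hvx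
    refine ⟨_, hdx.rpow_const (Or.inl hvx.ne'), ?_⟩
    have hcancel : v x ^ (((N : ℝ) - 1) / N) * v x ^ (1 / (N : ℝ) - 1) = 1 := by
      rw [← Real.rpow_add hvx, show ((N : ℝ) - 1) / N + (1 / (N : ℝ) - 1) = 0 by field_simp; ring,
        Real.rpow_zero]
    calc d * (1 / (N : ℝ)) * v x ^ (1 / (N : ℝ) - 1)
        ≤ -c * v x ^ (((N : ℝ) - 1) / N) * (1 / (N : ℝ)) * v x ^ (1 / (N : ℝ) - 1) := by
          gcongr
      _ = -c / N * (v x ^ (((N : ℝ) - 1) / N) * v x ^ (1 / (N : ℝ) - 1)) := by ring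
      _ = -c / N := by rw [hcancel, mul_one]
  have hkey := hw.sub_le_mul_of_ae_hasDerivAt_le ht₀ hd
  have hwt : 0 < v t ^ (1 / (N : ℝ)) := Real.rpow_pos_of_pos hvt _
  have hlen : v t₀ ^ (1 / (N : ℝ)) ≤ c / N * (t - t₀) := by
    calc v t₀ ^ (1 / (N : ℝ)) = c / N * (N / c * v t₀ ^ (1 / (N : ℝ))) := by field_simp
      _ ≤ c / N * (t - t₀) := by gcongr; linarith
  rw [neg_div, neg_mul] at hkey
  linarith
end
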